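/- Let R be a commutative regular noetherian ring (so that R has finite global dimension and all Tor groups of finitely generated modules vanish in sufficiently high degrees and are finitely generated). Then for every short exact sequence 0 → M' → M → M'' → 0 of finitely generated R-modules and every finitely generated R-module N, the equality Σ_{i ≥ 0} (−1)^i [Tor_i^R(M, N)] = Σ_{i ≥ 0} (−1)^i [Tor_i^R(M', N)] + Σ_{i ≥ 0} (−1)^i [Tor_i^R(M'', N)] holds in G₀(R); consequently ([M],[N]) ↦ Σ_{i ≥ 0} (−1)^i [Tor_i^R(M, N)] induces a well-defined ℤ-bilinear pairing G₀(R) × G₀(R) → G₀(R). -/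

import Mathlib

universe u

variable (R : Type u) [CommRing R]

/-- The (bundled) finitely generated `R`-modules. -/
def FGMod := { M : ModuleCat.{u} R // Module.Finite R M }

/-- The (bundled) finitely generated projective `R`-modules. -/
def FGProj := { M : ModuleCat.{u} R // Module.Finite R M ∧ Module.Projective R M }

/-- Isomorphism classes of finitely generated modules. -/
instance FGMod.setoid : Setoid (FGMod R) where
  r M N := Nonempty (M.1 ≃ₗ[R] N.1)
  iseqv := ⟨fun M => ⟨LinearEquiv.refl R M.1⟩,
    fun ⟨e⟩ => ⟨e.symm⟩, fun ⟨e⟩ ⟨f⟩ => ⟨e.trans f⟩⟩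

/-- Isomorphism classes of finitely generated projective modules. -/
instance FGProj.setoid : Setoid (FGProj R) where
  r M N := Nonempty (M.1 ≃ₗ[R] N.1)
  iseqv := ⟨fun M => ⟨LinearEquiv.refl R M.1⟩,
    fun ⟨e⟩ => ⟨e.symm⟩, fun ⟨e⟩ ⟨f⟩ => ⟨e.trans f⟩⟩

/-- The relations defining `G₀(R)`: one for each short exact sequence
`0 → M' → M → M'' → 0` of finitely generated `R`-modules. -/
def G0Rels : Set (FreeAbelianGroup (Quotient (FGMod.setoid R))) :=
  { x | ∃ (M' M M'' : FGMod R) (f : M'.1 →ₗ[R] M.1) (g : M.1 →ₗ[R] M''.1),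
      Function.Injective f ∧ Function.Surjective g ∧
        LinearMap.range f = LinearMap.ker g ∧
      x = FreeAbelianGroup.of ⟦M⟧ - FreeAbelianGroup.of ⟦M'⟧ -
        FreeAbelianGroup.of ⟦M''⟧ }

/-- The relations defining `K₀(R)`: one for each short exact sequence
`0 → M' → M → M'' → 0` of finitely generated projective `R`-modules. -/
def K0Rels : Set (FreeAbelianGroup (Quotient (FGProj.setoid R))) :=
  { x | ∃ (M' M M'' : FGProj R) (f : M'.1 →ₗ[R] M.1) (g : M.1 →ₗ[R] M''.1),
      Function.Injective f ∧ Function.Surjective g ∧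
        LinearMap.range f = LinearMap.ker g ∧
      x = FreeAbelianGroup.of ⟦M⟧ - FreeAbelianGroup.of ⟦M'⟧ -
        FreeAbelianGroup.of ⟦M''⟧ }

/-- `G₀(R)`, the Grothendieck group of finitely generated `R`-modules. -/
def G0 := FreeAbelianGroup (Quotient (FGMod.setoid R)) ⧸ AddSubgroup.closure (G0Rels R)

/-- `K₀(R)`, the Grothendieck group of finitely generated projective `R`-modules. -/
def K0 := FreeAbelianGroup (Quotient (FGProj.setoid R)) ⧸ AddSubgroup.closure (K0Rels R)

noncomputable instance : AddCommGroup (G0 R) := QuotientAddGroup.Quotient.addCommGroup _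
noncomputable instance : AddCommGroup (K0 R) := QuotientAddGroup.Quotient.addCommGroup _

/-- The class in `G₀(R)` of a finitely generated module. -/
def G0.mk {R : Type u} [CommRing R] (M : FGMod R) : G0 R :=
  QuotientAddGroup.mk (FreeAbelianGroup.of ⟦M⟧)

/-- The class in `K₀(R)` of a finitely generated projective module. -/
def K0.mk {R : Type u} [CommRing R] (M : FGProj R) : K0 R :=
  QuotientAddGroup.mk (FreeAbelianGroup.of ⟦M⟧)

/-- The class in `G₀(R)` of an unbundled finitely generated module. -/
def G0.of {R : Type u} [CommRing R] (M : Type u) [AddCommGroup M] [Module R M]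
    [Module.Finite R M] : G0 R :=
  G0.mk ⟨ModuleCat.of R M, ‹_›⟩

/-- The class in `K₀(R)` of an unbundled finitely generated projective module. -/
def K0.of {R : Type u} [CommRing R] (M : Type u) [AddCommGroup M] [Module R M]
    [Module.Finite R M] [hp : Module.Projective R M] : K0 R :=
  K0.mk ⟨ModuleCat.of R M, ‹_›, ‹_›⟩

/-- A commutative local ring is regular if it is noetherian and its Krull
dimension equals the dimension of the cotangent space `𝔪/𝔪²` over the residue
field `k = A/𝔪`. -/
def IsRegularLocal (B : Type u) [CommRing B] [IsLocalRing B] : Prop :=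
  IsNoetherianRing B ∧
    ringKrullDim B =
      (Module.finrank (IsLocalRing.ResidueField B) (IsLocalRing.CotangentSpace B) :
        WithBot ℕ∞)

open Classical in
/-- The class in `G₀(R)` of an arbitrary `R`-module: the class of the module if
it is finitely generated, and `0` otherwise (only used for finitely generated
modules). -/
noncomputable def G0.clsOf {R : Type u} [CommRing R] (M : ModuleCat.{u} R) : G0 R :=
  if h : Module.Finite R M then G0.mk ⟨M, h⟩ else 0

/-- `Tor_i^R(M, N)` as an object of the category of `R`-modules. -/
noncomputable def torObj {R : Type u} [CommRing R] (i : ℕ) (M N : ModuleCat.{u} R) :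
    ModuleCat.{u} R :=
  ((CategoryTheory.Tor (ModuleCat.{u} R) i).obj M).obj N

/-- The class `[Tor_i^R(M, N)] ∈ G₀(R)`. -/
noncomputable def torCls {R : Type u} [CommRing R] (i : ℕ) (M N : ModuleCat.{u} R) :
    G0 R :=
  G0.clsOf (torObj i M N)

section Resolution

open CategoryTheory CategoryTheory.Limits

universe v w v' w'

variable {C : Type w} [Category.{v} C] [Abelian C]

namespace CategoryTheory.ProjectiveResolution

/-- The augmentation map of a projective resolution. -/
noncomputable def augmentation {Z : C} (Q : ProjectiveResolution Z) : Q.complex.X 0 ⟶ Z := Q.π.f 0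

lemma d_comp_augmentation {Z : C} (Q : ProjectiveResolution Z) :
    Q.complex.d 1 0 ≫ Q.augmentation = 0 := Q.complex_d_comp_π_f_zero

instance {Z : C} (Q : ProjectiveResolution Z) : Epi Q.augmentation :=
  inferInstanceAs (Epi (Q.π.f 0))

lemma exact_augmentation {Z : C} (Q : ProjectiveResolution Z) :
    (ShortComplex.mk _ _ Q.d_comp_augmentation).Exact :=
  ShortComplex.exact_of_g_is_cokernel _ Q.isColimitCokernelCofork

lemma d_comp_augmentation_comp {Z X : C} (Q : ProjectiveResolution Z) (f : Z ⟶ X) :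
    Q.complex.d 1 0 ≫ Q.augmentation ≫ f = 0 := by
  rw [← Category.assoc, Q.d_comp_augmentation, zero_comp]

lemma augmentation_comp_f_comp_g {S : ShortComplex C} (Q : ProjectiveResolution S.X₁) :
    (Q.augmentation ≫ S.f) ≫ S.g = 0 := by
  rw [Category.assoc, S.zero, comp_zero]

/-- Splicing a projective resolution of `S.X₁` with a short exact sequence `S` whose middle term
is projective yields a projective resolution of `S.X₃`. -/
noncomputable def splice {S : ShortComplex C}
    (hS : S.ShortExact) [hP : Projective S.X₂] (Q : ProjectiveResolution S.X₁) :
    ProjectiveResolution S.X₃ where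
  complex := ChainComplex.augment Q.complex (Q.augmentation ≫ S.f) (Q.d_comp_augmentation_comp _)
  projective n := match n with
    | 0 => hP
    | n + 1 => Q.projective n
  π := (ChainComplex.toSingle₀Equiv _ _).symm ⟨S.g, Q.augmentation_comp_f_comp_g⟩
  quasiIso := ⟨fun n => by
    have hmono := hS.mono_f
    have hepi := hS.epi_g
    rcases n with _ | _ | n
    · rw [ChainComplex.quasiIsoAt₀_iff, ShortComplex.quasiIso_iff_of_zeros']
      · let φ : ShortComplex.mk (Q.augmentation ≫ S.f) S.g
            (by rw [Category.assoc, S.zero, comp_zero]) ⟶ S :=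
          { τ₁ := Q.augmentation, τ₂ := 𝟙 _, τ₃ := 𝟙 _ }
        have : Epi φ.τ₁ := inferInstanceAs (Epi Q.augmentation)
        have : IsIso φ.τ₂ := inferInstanceAs (IsIso (𝟙 S.X₂))
        have : Mono φ.τ₃ := inferInstanceAs (Mono (𝟙 S.X₃))
        refine (ShortComplex.exact_and_epi_g_iff_of_iso ?_).2
          ⟨(ShortComplex.exact_iff_of_epi_of_isIso_of_mono φ).2 hS.exact, hepi⟩
        exact ShortComplex.isoMk (Iso.refl _) (Iso.refl _) (Iso.refl _)
          ((Category.id_comp _).trans (Category.comp_id _).symm)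
          ((Category.id_comp S.g).trans
            ((ChainComplex.toSingle₀Equiv_symm_apply_f_zero
              (C := ChainComplex.augment Q.complex (Q.augmentation ≫ S.f)
                (Q.d_comp_augmentation_comp _)) S.g Q.augmentation_comp_f_comp_g).symm.trans
              (Category.comp_id _).symm))
      all_goals rfl
    · rw [quasiIsoAt_iff_exactAt']
      · rw [HomologicalComplex.exactAt_iff' _ 2 1 0 (by simp) (by simp)]
        let φ : ShortComplex.mk _ _ Q.d_comp_augmentation ⟶
            ShortComplex.mk _ _ (Q.d_comp_augmentation_comp S.f) :=
          { τ₁ := 𝟙 _, τ₂ := 𝟙 _, τ₃ := S.f }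
        have : Epi φ.τ₁ := inferInstanceAs (Epi (𝟙 _))
        have : IsIso φ.τ₂ := inferInstanceAs (IsIso (𝟙 _))
        have : Mono φ.τ₃ := inferInstanceAs (Mono S.f)
        exact (ShortComplex.exact_iff_of_epi_of_isIso_of_mono φ).1 Q.exact_augmentation
      · apply ChainComplex.exactAt_succ_single_obj
    · rw [quasiIsoAt_iff_exactAt']
      · rw [HomologicalComplex.exactAt_iff' _ (n + 3) (n + 2) (n + 1) (by simp) (by simp)]
        exact Q.exact_succ n
      · apply ChainComplex.exactAt_succ_single_obj⟩

end CategoryTheory.ProjectiveResolution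

variable {D : Type w'} [Category.{v'} D] [Abelian D] [HasProjectiveResolutions C]

/-- Dimension shifting for left derived functors. -/
theorem CategoryTheory.Functor.leftDerived_dimension_shift (F : C ⥤ D) [F.Additive]
    {S : ShortComplex C} (hS : S.ShortExact) [Projective S.X₂] (n : ℕ) :
    Nonempty ((F.leftDerived (n + 2)).obj S.X₃ ≅ (F.leftDerived (n + 1)).obj S.X₁) := by
  obtain ⟨Q⟩ : Nonempty (ProjectiveResolution S.X₁) := HasProjectiveResolution.out
  let K := (F.mapHomologicalComplex (ComplexShape.down ℕ)).obj (Q.splice hS).complex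
  let L := (F.mapHomologicalComplex (ComplexShape.down ℕ)).obj Q.complex
  refine ⟨(Q.splice hS).isoLeftDerivedObj F (n + 2) ≪≫ ?_ ≪≫
    (Q.isoLeftDerivedObj F (n + 1)).symm⟩
  exact K.homologyIsoSc' (n + 3) (n + 2) (n + 1) (by simp) (by simp) ≪≫
    (L.homologyIsoSc' (n + 2) (n + 1) n (by simp) (by simp)).symm

/-- The first left derived functor of a right exact functor is computed as a kernel. -/
theorem CategoryTheory.Functor.leftDerived_one_iso_kernel (F : C ⥤ D) [F.Additive]
    [PreservesFiniteColimits F] {S : ShortComplex C} (hS : S.ShortExact) [Projective S.X₂] :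
    Nonempty ((F.leftDerived 1).obj S.X₃ ≅ Limits.kernel (F.map S.f)) := by
  obtain ⟨Q⟩ : Nonempty (ProjectiveResolution S.X₁) := HasProjectiveResolution.out
  let K := (F.mapHomologicalComplex (ComplexShape.down ℕ)).obj (Q.splice hS).complex
  have hc := isColimitCoforkMapOfIsColimit' F Q.d_comp_augmentation Q.isColimitCokernelCofork
  let T : ShortComplex D := ShortComplex.mk (F.map (Q.complex.d 1 0))
    (F.map (Q.augmentation ≫ S.f))
    (by rw [← F.map_comp, Q.d_comp_augmentation_comp, F.map_zero])
  have wp : F.map (Q.complex.d 1 0) ≫ F.map Q.augmentation = 0 := by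
    rw [← F.map_comp, Q.d_comp_augmentation, F.map_zero]
  have hdesc : hc.desc (CokernelCofork.ofπ T.g T.zero) = F.map S.f :=
    Cofork.IsColimit.hom_ext hc <|
      (hc.fac _ WalkingParallelPair.one).trans (F.map_comp Q.augmentation S.f)
  let h : T.RightHomologyData :=
    { Q := F.obj S.X₁
      H := Limits.kernel (hc.desc (CokernelCofork.ofπ T.g T.zero))
      p := F.map Q.augmentation
      ι := Limits.kernel.ι _
      wp := wp
      hp := hc
      wι := Limits.kernel.condition _
      hι := kernelIsKernel _ }
  exact ⟨(Q.splice hS).isoLeftDerivedObj F 1 ≪≫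
    K.homologyIsoSc' 2 1 0 (by simp) (by simp) ≪≫ h.homologyIso ≪≫ kernelIsoOfEq hdesc⟩

end Resolution

section FiniteProjectiveDimension

open CategoryTheory

variable {B : Type u} [CommRing B]

/-- Projective dimension does not drop modulo a regular element. -/
theorem hasProjectiveDimensionLE_of_quotSMulTop [IsLocalRing B] [IsNoetherianRing B]
    {x : B} (hx : x ∈ IsLocalRing.maximalIdeal B) (hB : IsSMulRegular B x) (n : ℕ)
    (M : Type u) [AddCommGroup M] [Module B M] [Module.Finite B M] (hM : IsSMulRegular M x)
    (h : HasProjectiveDimensionLE (ModuleCat.of (B ⧸ Ideal.span {x}) (QuotSMulTop x M)) n) :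
    HasProjectiveDimensionLE (ModuleCat.of B M) n := by
  have hlt : Ideal.span {x} ≠ ⊤ := by
    rw [Ne, Ideal.span_singleton_eq_top]
    exact hx
  have : Nontrivial (B ⧸ Ideal.span {x}) := Ideal.Quotient.nontrivial_iff.2 hlt
  have : IsLocalRing (B ⧸ Ideal.span {x}) :=
    IsLocalRing.of_surjective' (Ideal.Quotient.mk _) Ideal.Quotient.mk_surjective
  induction n generalizing M with
  | zero =>
    have : Module.FinitePresentation B M := Module.finitePresentation_of_finite B M
    simp only [HasProjectiveDimensionLE, zero_add, ← projective_iff_hasProjectiveDimensionLT_one,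
      ← IsProjective.iff_projective] at h ⊢
    have := Module.Finite.of_restrictScalars_finite B (B ⧸ Ideal.span {x}) (QuotSMulTop x M)
    have hfree : Module.Free (B ⧸ Ideal.span {x}) (QuotSMulTop x M) :=
      Module.free_of_flat_of_isLocalRing
    have := (Module.free_quotSMulTop_iff_free B M
      (IsLocalRing.maximalIdeal_le_jacobson ⊥ hx) hM).1 hfree
    infer_instance
  | succ n ih =>
    obtain ⟨P, _, _, _, _, f, hf⟩ := Module.exists_finite_presentation B M
    have hP : IsSMulRegular P x :=
      ((Module.Free.chooseBasis B P).equivFun.isSMulRegular_congr x).2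
        (IsSMulRegular.pi fun _ => hB)
    have hK : IsSMulRegular (LinearMap.ker f) x := hP.submodule _ _
    have hS := LinearMap.shortExact_shortComplexKer hf
    have hproj : Projective (f.shortComplexKer).X₂ := inferInstance
    refine (hS.hasProjectiveDimensionLT_X₃_iff n hproj).2 (ih (LinearMap.ker f) hK ?_)
    have hsurj : Function.Surjective (algebraMap B (B ⧸ Ideal.span {x})) :=
      Ideal.Quotient.mk_surjective
    have hex : Function.Exact (LinearMap.ker f).subtype f := LinearMap.exact_subtype_ker_map f
    have hzero : Function.Exact (0 : PUnit.{u+1} →ₗ[B] LinearMap.ker f)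
        (LinearMap.ker f).subtype := by
      rw [LinearMap.exact_zero_iff_injective]
      exact Subtype.val_injective
    let i := (QuotSMulTop.map x (LinearMap.ker f).subtype).extendScalarsOfSurjective hsurj
    let g := (QuotSMulTop.map x f).extendScalarsOfSurjective hsurj
    have hg : Function.Surjective g := QuotSMulTop.map_surjective x hf
    have hig : Function.Exact i g := QuotSMulTop.map_exact x hex hf
    have hi : Function.Injective i := by
      have := QuotSMulTop.map_first_exact_on_four_term_exact_of_isSMulRegular_last hzero hex hM
      rw [map_zero, LinearMap.exact_zero_iff_injective] at this
      exact this
    let T : ShortComplex (ModuleCat.{u} (B ⧸ Ideal.span {x})) :=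
      ShortComplex.mk (ModuleCat.ofHom i) (ModuleCat.ofHom g)
        (by ext : 1; exact hig.linearMap_comp_eq_zero)
    have hT : T.ShortExact := ModuleCat.shortComplex_shortExact T hig hi hg
    have hproj' : Projective T.X₂ := by
      rw [← IsProjective.iff_projective]
      exact inferInstanceAs (Module.Projective _ (QuotSMulTop x P))
    exact (hT.hasProjectiveDimensionLT_X₃_iff n hproj').1 h

open IsLocalRing in
/-- Cutting a regular local ring by an element outside `𝔪²` gives a regular local ring of
dimension one less. -/
theorem IsRegularLocalRing.quotient_span_singleton [IsRegularLocalRing B] {x : B}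
    (hx : x ∈ maximalIdeal B) (hx2 : x ∉ maximalIdeal B ^ 2) {d : ℕ}
    (hd : ringKrullDim B = (d + 1 : ℕ)) :
    IsRegularLocalRing (B ⧸ Ideal.span {x}) ∧
      (d : WithBot ℕ∞) ≤ ringKrullDim (B ⧸ Ideal.span {x}) ∧
      ringKrullDim (B ⧸ Ideal.span {x}) ≤ d := by
  have hlt : Ideal.span {x} ≠ ⊤ := by
    rw [Ne, Ideal.span_singleton_eq_top]
    exact hx
  have : Nontrivial (B ⧸ Ideal.span {x}) := Ideal.Quotient.nontrivial_iff.2 hlt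
  have : IsLocalRing (B ⧸ Ideal.span {x}) :=
    IsLocalRing.of_surjective' (Ideal.Quotient.mk _) Ideal.Quotient.mk_surjective
  have hdim : (d : WithBot ℕ∞) ≤ ringKrullDim (B ⧸ Ideal.span {x}) := by
    have := ringKrullDim_le_ringKrullDim_quotSMulTop_succ hx
    rw [← Submodule.ideal_span_singleton_smul, smul_eq_mul, Ideal.mul_top, hd] at this
    simpa [ENat.WithBot.add_le_add_one_right_iff] using this
  have hspan : (maximalIdeal (B ⧸ Ideal.span {x})).spanFinrank ≤ d := by
    classical
    obtain ⟨s, hscard, hs⟩ := Submodule.FG.exists_span_finset_card_eq_spanFinrank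
      (IsNoetherian.noetherian (maximalIdeal B))
    have hcard : s.card = d + 1 := by
      have := IsRegularLocalRing.spanFinrank_maximalIdeal (R := B)
      rw [hd] at this
      rw [hscard]
      exact_mod_cast this
    have hxs : x ∈ Submodule.span B (s : Set B) := hs ▸ hx
    obtain ⟨c, -, hc⟩ := Submodule.mem_span_finset.1 hxs
    obtain ⟨a, has, ha⟩ : ∃ a ∈ s, IsUnit (c a) := by
      by_contra! hcon
      refine hx2 (hc ▸ Ideal.sum_mem _ fun a ha => ?_)
      rw [pow_two, smul_eq_mul]
      exact Ideal.mul_mem_mul (hcon a ha) (hs ▸ Submodule.subset_span ha)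
    set q := Ideal.Quotient.mk (Ideal.span {x})
    have hmax : maximalIdeal (B ⧸ Ideal.span {x}) = Ideal.map q (maximalIdeal B) :=
      (map_maximalIdeal_of_surjective q Ideal.Quotient.mk_surjective).symm
    have hqa : q a ∈ Ideal.span (q '' (s.erase a : Set B)) := by
      have hsum : q (c a) * q a + ∑ b ∈ s.erase a, q (c b) * q b = 0 := by
        rw [Finset.add_sum_erase s (fun b => q (c b) * q b) has]
        simp only [← map_mul, ← map_sum]
        exact Ideal.Quotient.eq_zero_iff_mem.2 (hc ▸ Ideal.mem_span_singleton_self x)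
      rw [← Ideal.unit_mul_mem_iff_mem _ (ha.map q), eq_neg_of_add_eq_zero_left hsum]
      exact neg_mem (Ideal.sum_mem _ fun b hb => Ideal.mul_mem_left _ _
        (Ideal.subset_span ⟨b, hb, rfl⟩))
    have hle : maximalIdeal (B ⧸ Ideal.span {x}) =
        Submodule.span _ (((s.erase a).image q : Finset _) : Set (B ⧸ Ideal.span {x})) := by
      rw [hmax, ← hs]
      change Ideal.map q (Ideal.span s) = Ideal.span _
      rw [Ideal.map_span, Finset.coe_image, ← Finset.insert_erase has, Finset.coe_insert,
        Set.image_insert_eq, Finset.erase_insert_eq_erase, Finset.erase_idem]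
      exact Submodule.span_insert_eq_span hqa
    rw [hle]
    refine (Submodule.spanFinrank_span_le_ncard_of_finite (Finset.finite_toSet _)).trans ?_
    rw [Set.ncard_coe_finset]
    refine Finset.card_image_le.trans ?_
    rw [Finset.card_erase_of_mem has, hcard, Nat.add_sub_cancel]
  refine ⟨of_spanFinrank_maximalIdeal_le _ (le_trans ?_ hdim), hdim, ?_⟩
  · exact_mod_cast hspan
  · refine (ringKrullDim_le_spanFinrank_maximalIdeal _).trans ?_
    exact_mod_cast hspan

open IsLocalRing in
/-- A regular local ring of positive dimension contains an element of `𝔪 \ 𝔪²` avoiding all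
minimal primes. -/
theorem IsRegularLocalRing.exists_mem_maximalIdeal_notMem [IsRegularLocalRing B] {d : ℕ}
    (hd : ringKrullDim B = (d + 1 : ℕ)) :
    ∃ x ∈ maximalIdeal B, x ∉ maximalIdeal B ^ 2 ∧ ∀ p ∈ minimalPrimes B, x ∉ p := by
  by_contra! hcon
  have hfin : (insert (maximalIdeal B ^ 2) (minimalPrimes B)).Finite :=
    (minimalPrimes.finite_of_isNoetherianRing B).insert _
  obtain ⟨I, hI, hle⟩ := (Ideal.subset_union_prime_finite (f := id) hfin (maximalIdeal B ^ 2)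
    (maximalIdeal B ^ 2) (I := maximalIdeal B)
    (fun I hI hne _ => (hI.resolve_left hne).1.1)).1 fun x hx => by
      by_cases hx2 : x ∈ maximalIdeal B ^ 2
      · exact Set.mem_biUnion (Set.mem_insert _ _) hx2
      · obtain ⟨p, hp, hxp⟩ := hcon x hx hx2
        exact Set.mem_biUnion (Set.mem_insert_of_mem _ hp) hxp
  rcases hI with rfl | hI
  · have hbot : maximalIdeal B = ⊥ :=
      Submodule.eq_bot_of_le_smul_of_le_jacobson_bot (maximalIdeal B) _
        (IsNoetherian.noetherian _) (by simpa [pow_two] using hle) (maximalIdeal_le_jacobson ⊥)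
    have := IsRegularLocalRing.spanFinrank_maximalIdeal (R := B)
    rw [hd, hbot, Submodule.spanFinrank_bot] at this
    exact absurd this.symm (by exact_mod_cast d.succ_ne_zero)
  · have := maximalIdeal_height_eq_ringKrullDim (R := B)
    have hmin : maximalIdeal B ∈ minimalPrimes B :=
      le_antisymm (le_maximalIdeal hI.1.1.ne_top) hle ▸ hI
    rw [hd, Ideal.height_eq_zero_iff.2 hmin] at this
    exact absurd this.symm (by exact_mod_cast d.succ_ne_zero)

open IsLocalRing in
/-- A regular local ring of dimension `d` is a domain, and all its finitely generated modules
have projective dimension at most `d`. -/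
theorem IsRegularLocalRing.isDomain_and_hasProjectiveDimensionLE (d : ℕ) (B : Type u) [CommRing B]
    [IsRegularLocalRing B] (hd : ringKrullDim B = d) :
    IsDomain B ∧ ∀ (M : Type u) [AddCommGroup M] [Module B M] [Module.Finite B M],
      HasProjectiveDimensionLE (ModuleCat.of B M) d := by
  induction d generalizing B with
  | zero =>
    have hbot : maximalIdeal B = ⊥ := by
      have := IsRegularLocalRing.spanFinrank_maximalIdeal (R := B)
      rw [hd] at this
      rw [← Submodule.spanFinrank_eq_zero_iff_eq_bot (IsNoetherian.noetherian _)]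
      exact_mod_cast this
    have hfield : IsField B := isField_iff_maximalIdeal_eq.2 hbot
    refine ⟨hfield.isDomain, fun M _ _ _ => ?_⟩
    let _ := hfield.toField
    simp only [HasProjectiveDimensionLE, zero_add, ← projective_iff_hasProjectiveDimensionLT_one,
      ← IsProjective.iff_projective]
    exact Module.Projective.of_free (R := B) (P := M)
  | succ d ih =>
    obtain ⟨x, hx, hx2, hmin⟩ := exists_mem_maximalIdeal_notMem hd
    obtain ⟨hreg, h₁, h₂⟩ := quotient_span_singleton hx hx2 hd
    obtain ⟨hdom, hpd⟩ := ih (B ⧸ Ideal.span {x}) (le_antisymm h₂ h₁)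
    have hprime : (Ideal.span {x}).IsPrime := (Ideal.Quotient.isDomain_iff_prime _).1 hdom
    obtain ⟨p, hp, hle⟩ := Ideal.exists_minimalPrimes_le (bot_le (a := Ideal.span {x}))
    have hpbot : p = ⊥ := by
      refine Submodule.eq_bot_of_le_smul_of_le_jacobson_bot (Ideal.span {x}) _
        (IsNoetherian.noetherian _) (fun y hy => ?_)
        (((Ideal.span_singleton_le_iff_mem _).2 hx).trans (maximalIdeal_le_jacobson ⊥))
      obtain ⟨z, rfl⟩ := Ideal.mem_span_singleton'.1 (hle hy)
      rw [mul_comm]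
      exact Submodule.smul_mem_smul (Ideal.mem_span_singleton_self x)
        ((hp.1.1.mem_or_mem hy).resolve_right (hmin p hp))
    have hB : IsDomain B := by
      have : (⊥ : Ideal B).IsPrime := hpbot ▸ hp.1.1
      exact IsDomain.of_bot_isPrime B
    have hx0 : x ≠ 0 := fun h => hmin p hp (h ▸ p.zero_mem)
    have hxB : IsSMulRegular B x := fun a b h => mul_left_cancel₀ hx0 h
    refine ⟨hB, fun M _ _ _ => ?_⟩
    obtain ⟨P, _, _, _, _, f, hf⟩ := Module.exists_finite_presentation B M
    have hP : IsSMulRegular P x :=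
      ((Module.Free.chooseBasis B P).equivFun.isSMulRegular_congr x).2
        (IsSMulRegular.pi fun _ => hxB)
    have hproj : Projective (f.shortComplexKer).X₂ := inferInstance
    have : Module.Finite (B ⧸ Ideal.span {x}) (QuotSMulTop x (LinearMap.ker f)) :=
      Module.Finite.of_restrictScalars_finite B _ _
    exact ((LinearMap.shortExact_shortComplexKer hf).hasProjectiveDimensionLT_X₃_iff d hproj).2
      (hasProjectiveDimensionLE_of_quotSMulTop hx hxB d _ (hP.submodule _ _) (hpd _))

variable {R} [IsNoetherianRing R]

/-- Projective dimension at most `n` is an open condition on finitely generated modules. -/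
theorem isOpen_setOf_hasProjectiveDimensionLE_localizedModule (n : ℕ) (M : ModuleCat.{u} R)
    [Module.Finite R M] :
    IsOpen {p : PrimeSpectrum R |
      HasProjectiveDimensionLE (M.localizedModule p.asIdeal.primeCompl) n} := by
  induction n generalizing M with
  | zero =>
    have : Module.FinitePresentation R M := Module.finitePresentation_of_finite R M
    convert Module.isOpen_freeLocus (R := R) (M := M) using 1
    ext p
    let e : M.localizedModule p.asIdeal.primeCompl ≃ₗ[Localization.AtPrime p.asIdeal]
        LocalizedModule p.asIdeal.primeCompl M :=
      LinearEquiv.extendScalarsOfIsLocalization p.asIdeal.primeCompl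
        (Localization.AtPrime p.asIdeal) (IsLocalizedModule.linearEquiv p.asIdeal.primeCompl
        (M.localizedModuleMkLinearMap p.asIdeal.primeCompl)
        (LocalizedModule.mkLinearMap p.asIdeal.primeCompl M))
    have h₁ : HasProjectiveDimensionLE (M.localizedModule p.asIdeal.primeCompl) 0 ↔
        Module.Projective (Localization p.asIdeal.primeCompl)
          (M.localizedModule p.asIdeal.primeCompl) := by
      rw [IsProjective.iff_projective, projective_iff_hasProjectiveDimensionLT_one,
        HasProjectiveDimensionLE]
    refine h₁.trans (Iff.trans ⟨fun h => ?_, fun h => ?_⟩ Module.mem_freeLocus.symm)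
    · have : Module.Projective (Localization.AtPrime p.asIdeal)
        (LocalizedModule p.asIdeal.primeCompl M) := Module.Projective.of_equiv e
      have : Module.Finite (Localization.AtPrime p.asIdeal)
        (LocalizedModule p.asIdeal.primeCompl M) := inferInstance
      have : Module.Flat (Localization.AtPrime p.asIdeal)
        (LocalizedModule p.asIdeal.primeCompl M) := Module.Flat.of_projective
      exact Module.free_of_flat_of_isLocalRing
    · have : Module.Free (Localization.AtPrime p.asIdeal)
        (LocalizedModule p.asIdeal.primeCompl M) := h
      have := Module.Projective.of_free (R := Localization.AtPrime p.asIdeal)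
        (P := LocalizedModule p.asIdeal.primeCompl M)
      exact Module.Projective.of_equiv e.symm
  | succ n ih =>
    obtain ⟨P, _, _, _, _, f, hf⟩ := Module.exists_finite_presentation R M
    have hS := LinearMap.shortExact_shortComplexKer hf
    have hproj : Projective (f.shortComplexKer).X₂ := inferInstance
    convert ih (ModuleCat.of R (LinearMap.ker f)) using 1
    ext p
    let F := ModuleCat.localizedModuleFunctor.{u} p.asIdeal.primeCompl
    exact (hS.map_of_exact F).hasProjectiveDimensionLT_X₃_iff n
      (F.projective_obj_of_projective hproj)

/-- Finitely generated modules over a regular noetherian ring have finite projective dimension. -/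
theorem exists_hasProjectiveDimensionLE_of_isRegularLocalRing
    (hreg : ∀ (p : Ideal R) [p.IsPrime], IsRegularLocalRing (Localization.AtPrime p))
    (M : ModuleCat.{u} R) [Module.Finite R M] : ∃ n, HasProjectiveDimensionLE M n := by
  let U (n : ℕ) : Set (PrimeSpectrum R) :=
    {p | HasProjectiveDimensionLE (M.localizedModule p.asIdeal.primeCompl) n}
  have hmono : Monotone U := fun m n hmn p hp => by
    have : HasProjectiveDimensionLT (M.localizedModule p.asIdeal.primeCompl) (m + 1) := hp
    exact hasProjectiveDimensionLT_of_ge _ (m + 1) (n + 1) (by omega)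
  obtain ⟨n, hn⟩ := isCompact_univ.elim_directed_cover U
    (fun n => isOpen_setOf_hasProjectiveDimensionLE_localizedModule n M)
    (fun p _ => by
      have := hreg p.asIdeal
      have : Module.Finite (Localization.AtPrime p.asIdeal)
          (M.localizedModule p.asIdeal.primeCompl) :=
        Module.Finite.of_isLocalizedModule p.asIdeal.primeCompl
          (M.localizedModuleMkLinearMap p.asIdeal.primeCompl)
      exact Set.mem_iUnion.2 ⟨_, (IsRegularLocalRing.isDomain_and_hasProjectiveDimensionLE _
        (Localization.AtPrime p.asIdeal)
        IsRegularLocalRing.spanFinrank_maximalIdeal.symm).2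
        (M.localizedModule p.asIdeal.primeCompl)⟩)
    hmono.directed_le
  exact ⟨n, (M.hasProjectiveDimensionLE_iff_forall_primeSpectrum n).2
    fun p => hn (Set.mem_univ p)⟩
end FiniteProjectiveDimension

section EulerCharacteristic

open CategoryTheory CategoryTheory.Limits MonoidalCategory

variable {R}

namespace G0

lemma mk_eq_add {M' M M'' : FGMod R} (f : M'.1 →ₗ[R] M.1) (g : M.1 →ₗ[R] M''.1)
    (hf : Function.Injective f) (hg : Function.Surjective g)
    (hfg : LinearMap.range f = LinearMap.ker g) : mk M = mk M' + mk M'' := by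
  rw [← sub_eq_zero, ← sub_sub]
  exact (QuotientAddGroup.eq_zero_iff _).2
    (AddSubgroup.subset_closure ⟨M', M, M'', f, g, hf, hg, hfg, rfl⟩)

/-- The universal property of `G₀(R)`: a function on finitely generated modules which is additive
on short exact sequences extends to `G₀(R)`. -/
noncomputable def lift {A : Type*} [AddCommGroup A] (φ : FGMod R → A)
    (h : ∀ (M' M M'' : FGMod R) (f : M'.1 →ₗ[R] M.1) (g : M.1 →ₗ[R] M''.1),
      Function.Injective f → Function.Surjective g → LinearMap.range f = LinearMap.ker g →
      φ M = φ M' + φ M'') : G0 R →+ A :=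
  QuotientAddGroup.lift _ (FreeAbelianGroup.lift (Quotient.lift φ (by
    rintro M N ⟨e⟩
    let Z : FGMod R := ⟨ModuleCat.of R PUnit, inferInstance⟩
    have hZ : φ Z = φ Z + φ Z := h Z Z Z 0 0 (Function.injective_of_subsingleton _)
      (Function.surjective_to_subsingleton _) (Subsingleton.elim _ _)
    have hMN := h Z M N 0 e.toLinearMap (Function.injective_of_subsingleton _) e.surjective
      (by rw [LinearMap.range_zero, LinearEquiv.ker])
    rwa [left_eq_add.1 hZ, zero_add] at hMN))) (by
    rw [AddSubgroup.closure_le]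
    rintro _ ⟨M', M, M'', f, g, hf, hg, hfg, rfl⟩
    rw [SetLike.mem_coe, AddMonoidHom.mem_ker]
    simp only [map_sub, FreeAbelianGroup.lift_apply_of, Quotient.lift_mk]
    rw [h M' M M'' f g hf hg hfg]
    abel)

@[simp]
lemma lift_mk {A : Type*} [AddCommGroup A] (φ : FGMod R → A)
    (h : ∀ (M' M M'' : FGMod R) (f : M'.1 →ₗ[R] M.1) (g : M.1 →ₗ[R] M''.1),
      Function.Injective f → Function.Surjective g → LinearMap.range f = LinearMap.ker g →
      φ M = φ M' + φ M'') (M : FGMod R) : lift φ h (mk M) = φ M :=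
  FreeAbelianGroup.lift_apply_of _ _

lemma hom_ext {A : Type*} [AddCommGroup A] {φ ψ : G0 R →+ A} (h : ∀ M, φ (mk M) = ψ (mk M)) :
    φ = ψ := by
  refine QuotientAddGroup.addMonoidHom_ext _ (FreeAbelianGroup.lift_ext _ _ ?_)
  rintro ⟨M⟩
  exact h M

lemma clsOf_eq_mk (M : ModuleCat.{u} R) [h : Module.Finite R M] : clsOf M = mk ⟨M, h⟩ :=
  dif_pos h

lemma clsOf_congr {M N : ModuleCat.{u} R} (e : M ≅ N) : clsOf M = clsOf N := by
  by_cases h : Module.Finite R M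
  · have := Module.Finite.equiv e.toLinearEquiv
    rw [clsOf_eq_mk, clsOf_eq_mk]
    exact congrArg (fun x => QuotientAddGroup.mk (FreeAbelianGroup.of x))
      (Quotient.sound ⟨e.toLinearEquiv⟩)
  · have : ¬ Module.Finite R N := fun _ => h (Module.Finite.equiv e.symm.toLinearEquiv)
    rw [clsOf, clsOf, dif_neg h, dif_neg this]

/-- The class in `G₀(R)` is additive on short exact sequences. -/
lemma clsOf_eq_add {M' M M'' : Type u} [AddCommGroup M'] [AddCommGroup M] [AddCommGroup M'']
    [Module R M'] [Module R M] [Module R M''] [Module.Finite R M'] [Module.Finite R M]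
    [Module.Finite R M''] {f : M' →ₗ[R] M} {g : M →ₗ[R] M''} (hf : Function.Injective f)
    (hg : Function.Surjective g) (hfg : Function.Exact f g) :
    clsOf (ModuleCat.of R M) = clsOf (ModuleCat.of R M') + clsOf (ModuleCat.of R M'') := by
  have : Module.Finite R (ModuleCat.of R M') := ‹Module.Finite R M'›
  have : Module.Finite R (ModuleCat.of R M) := ‹Module.Finite R M›
  have : Module.Finite R (ModuleCat.of R M'') := ‹Module.Finite R M''›
  rw [clsOf_eq_mk, clsOf_eq_mk, clsOf_eq_mk]
  exact mk_eq_add f g hf hg hfg.linearMap_ker_eq.symm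

lemma clsOf_of_isZero {M : ModuleCat.{u} R} (h : IsZero M) : clsOf M = 0 := by
  have := ModuleCat.subsingleton_of_isZero h
  exact left_eq_add.1 (clsOf_eq_add (f := (0 : M →ₗ[R] M)) (g := (0 : M →ₗ[R] M))
    (Function.injective_of_subsingleton _) (Function.surjective_to_subsingleton _)
    fun _ => ⟨fun _ => ⟨0, Subsingleton.elim _ _⟩, fun _ => Subsingleton.elim _ _⟩)

/-- The class of the kernel of the first map in a right exact sequence. -/
lemma clsOf_ker [IsNoetherianRing R] {A B C : Type u} [AddCommGroup A] [AddCommGroup B]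
    [AddCommGroup C] [Module R A] [Module R B] [Module R C] [Module.Finite R A]
    [Module.Finite R B] [Module.Finite R C] {f : A →ₗ[R] B} {g : B →ₗ[R] C}
    (hg : Function.Surjective g) (hfg : Function.Exact f g) :
    clsOf (ModuleCat.of R (LinearMap.ker f)) =
      clsOf (ModuleCat.of R A) - clsOf (ModuleCat.of R B) + clsOf (ModuleCat.of R C) := by
  have h₁ := clsOf_eq_add (LinearMap.ker f).subtype_injective f.surjective_rangeRestrict
    (fun x => by simp [Subtype.ext_iff])
  have h₂ := clsOf_eq_add (LinearMap.range f).subtype_injective hg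
    (fun x => by simpa using hfg x)
  rw [h₁, h₂]
  abel

end G0

lemma torObj_dimension_shift (M : ModuleCat.{u} R) {S : ShortComplex (ModuleCat.{u} R)}
    (hS : S.ShortExact) [Projective S.X₂] (n : ℕ) :
    Nonempty (torObj (n + 2) M S.X₃ ≅ torObj (n + 1) M S.X₁) :=
  ((tensoringLeft (ModuleCat.{u} R)).obj M).leftDerived_dimension_shift hS n

lemma torObj_one_iso_ker (M : ModuleCat.{u} R) {S : ShortComplex (ModuleCat.{u} R)}
    (hS : S.ShortExact) [Projective S.X₂] :
    Nonempty (torObj 1 M S.X₃ ≅ ModuleCat.of R (LinearMap.ker (S.f.hom.lTensor M))) := by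
  obtain ⟨e⟩ := ((tensoringLeft (ModuleCat.{u} R)).obj M).leftDerived_one_iso_kernel hS
  exact ⟨e ≪≫ ModuleCat.kernelIsoKer (M ◁ S.f)⟩

/-- `Tor₀` is the tensor product. -/
noncomputable def torObjZeroIso (M N : ModuleCat.{u} R) :
    torObj 0 M N ≅ ModuleCat.of R (TensorProduct R M N) :=
  ((tensoringLeft (ModuleCat.{u} R)).obj M).leftDerivedZeroIsoSelf.app N

lemma isZero_torObj_of_projective (n : ℕ) (M N : ModuleCat.{u} R) [Projective N] :
    IsZero (torObj (n + 1) M N) :=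
  isZero_Tor_succ_of_projective _ M N n

lemma isZero_torObj_of_hasProjectiveDimensionLE (n : ℕ) (M N : ModuleCat.{u} R)
    (hN : HasProjectiveDimensionLE N n) {i : ℕ} (hi : n < i) : IsZero (torObj i M N) := by
  induction n generalizing N i with
  | zero =>
    obtain ⟨i, rfl⟩ := Nat.exists_eq_add_of_lt hi
    simp only [HasProjectiveDimensionLE, zero_add,
      ← projective_iff_hasProjectiveDimensionLT_one] at hN
    rw [zero_add]
    exact isZero_torObj_of_projective i M N
  | succ n ih =>
    obtain ⟨i, rfl⟩ : ∃ j, i = j + 2 := ⟨i - 2, by omega⟩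
    obtain ⟨⟨P, f⟩⟩ := EnoughProjectives.presentation N
    let S := ShortComplex.mk (kernel.ι f) f (kernel.condition f)
    have hS : S.ShortExact := { exact := ShortComplex.exact_kernel f }
    have hP : Projective S.X₂ := ‹_›
    obtain ⟨e⟩ := torObj_dimension_shift M hS i
    exact (ih _ ((hS.hasProjectiveDimensionLT_X₃_iff n hP).1 hN) (by omega)).of_iso e

/-- `Tor` of finite modules over a noetherian ring is finite. -/
instance finite_torObj [IsNoetherianRing R] (n : ℕ) (M N : ModuleCat.{u} R) [Module.Finite R M]
    [Module.Finite R N] :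
    Module.Finite R (torObj n M N) := by
  induction n using Nat.strong_induction_on generalizing N with
  | _ n ih =>
    obtain ⟨P, _, _, _, _, f, hf⟩ := Module.exists_finite_presentation R N
    have hS := LinearMap.shortExact_shortComplexKer hf
    have hP : Projective (f.shortComplexKer).X₂ := inferInstance
    match n with
    | 0 =>
      exact Module.Finite.equiv (M := TensorProduct R M N) (torObjZeroIso M N).toLinearEquiv.symm
    | 1 =>
      obtain ⟨e⟩ := torObj_one_iso_ker M hS
      exact Module.Finite.equiv (M := LinearMap.ker
        ((LinearMap.ker f).subtype.lTensor M)) e.toLinearEquiv.symm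
    | n + 2 =>
      obtain ⟨e⟩ := torObj_dimension_shift M hS n
      have := ih (n + 1) (by omega) (ModuleCat.of R (LinearMap.ker f))
      exact Module.Finite.equiv e.toLinearEquiv.symm

/-- The Euler characteristic of `Tor(M, N)`, truncated in degrees `≤ n`. -/
noncomputable def torEuler (n : ℕ) (M N : ModuleCat.{u} R) : G0 R :=
  ∑ i ∈ Finset.range (n + 1), ((-1 : ℤ) ^ i) • torCls i M N

lemma torCls_zero (M N : ModuleCat.{u} R) :
    torCls 0 M N = G0.clsOf (ModuleCat.of R (TensorProduct R M N)) :=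
  G0.clsOf_congr (torObjZeroIso M N)

lemma torEuler_zero (M N : ModuleCat.{u} R) :
    torEuler 0 M N = G0.clsOf (ModuleCat.of R (TensorProduct R M N)) := by
  simp [torEuler, torCls_zero]

lemma torEuler_eq_of_isZero {n m : ℕ} {M N : ModuleCat.{u} R}
    (h : ∀ i, n < i → IsZero (torObj i M N)) (hnm : n ≤ m) : torEuler m M N = torEuler n M N := by
  refine (Finset.sum_subset (Finset.range_mono (by omega)) fun i _ hi => ?_).symm
  rw [torCls, G0.clsOf_of_isZero (h i (by simpa using hi)), smul_zero]

/-- Tensoring with a finite projective module is additive on classes. -/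
lemma clsOf_tensor_eq_add_of_projective {M' M M'' N : Type u} [AddCommGroup M'] [AddCommGroup M]
    [AddCommGroup M''] [AddCommGroup N] [Module R M'] [Module R M] [Module R M''] [Module R N]
    [Module.Finite R M'] [Module.Finite R M] [Module.Finite R M''] [Module.Finite R N]
    [Module.Projective R N] {f : M' →ₗ[R] M} {g : M →ₗ[R] M''} (hf : Function.Injective f)
    (hg : Function.Surjective g) (hfg : Function.Exact f g) :
    G0.clsOf (ModuleCat.of R (TensorProduct R M N)) =
      G0.clsOf (ModuleCat.of R (TensorProduct R M' N)) +
        G0.clsOf (ModuleCat.of R (TensorProduct R M'' N)) :=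
  G0.clsOf_eq_add (Module.Flat.rTensor_preserves_injective_linearMap f hf)
    (LinearMap.rTensor_surjective N hg) (rTensor_exact N hfg hg)

/-- Tensoring is additive on classes of short exact sequences ending in a projective module. -/
lemma clsOf_tensor_eq_add_of_projective_right {M N' N N'' : Type u} [AddCommGroup N']
    [AddCommGroup N] [AddCommGroup N''] [AddCommGroup M] [Module R N'] [Module R N]
    [Module R N''] [Module R M] [Module.Finite R N'] [Module.Finite R N] [Module.Finite R N'']
    [Module.Finite R M] [Module.Projective R N''] {f : N' →ₗ[R] N} {g : N →ₗ[R] N''}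
    (hf : Function.Injective f) (hg : Function.Surjective g) (hfg : Function.Exact f g) :
    G0.clsOf (ModuleCat.of R (TensorProduct R M N)) =
      G0.clsOf (ModuleCat.of R (TensorProduct R M N')) +
        G0.clsOf (ModuleCat.of R (TensorProduct R M N'')) := by
  obtain ⟨s, hs⟩ := Module.projective_lifting_property g LinearMap.id hg
  have hsplit : (∃ s, g ∘ₗ s = LinearMap.id) ↔ ∃ r, r ∘ₗ f = LinearMap.id :=
    (hfg.split_tfae hf hg).out 0 1
  obtain ⟨r, hr⟩ := hsplit.1 ⟨s, hs⟩
  refine G0.clsOf_eq_add (f := f.lTensor M) (Function.LeftInverse.injective (g := r.lTensor M) ?_)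
    (LinearMap.lTensor_surjective M hg) (lTensor_exact M hfg hg)
  intro x
  rw [← LinearMap.comp_apply, ← LinearMap.lTensor_comp, hr, LinearMap.lTensor_id,
    LinearMap.id_apply]

section Additivity

variable [IsNoetherianRing R]

/-- Recursion for the Euler characteristic of `Tor` along a presentation of the second argument by
a projective module. -/
lemma torEuler_succ (n : ℕ) (M : ModuleCat.{u} R) [Module.Finite R M] {N P : Type u}
    [AddCommGroup N] [Module R N] [AddCommGroup P] [Module R P] [Module.Finite R N]
    [Module.Finite R P] [Module.Projective R P] (f : P →ₗ[R] N) (hf : Function.Surjective f) :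
    torEuler (n + 1) M (ModuleCat.of R N) =
      G0.clsOf (ModuleCat.of R (TensorProduct R M P)) -
        torEuler n M (ModuleCat.of R (LinearMap.ker f)) := by
  have hS := LinearMap.shortExact_shortComplexKer hf
  have hP : Projective (f.shortComplexKer).X₂ :=
    (IsProjective.iff_projective P).1 ‹Module.Projective R P›
  have hone : torCls 1 M (ModuleCat.of R N) =
      torCls 0 M (ModuleCat.of R (LinearMap.ker f)) -
        G0.clsOf (ModuleCat.of R (TensorProduct R M P)) + torCls 0 M (ModuleCat.of R N) := by
    obtain ⟨e⟩ := torObj_one_iso_ker M hS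
    rw [torCls_zero, torCls_zero, torCls, G0.clsOf_congr e]
    exact G0.clsOf_ker (LinearMap.lTensor_surjective M hf)
      (lTensor_exact M (LinearMap.exact_subtype_ker_map f) hf)
  have hshift (i : ℕ) : torCls (i + 2) M (ModuleCat.of R N) =
      torCls (i + 1) M (ModuleCat.of R (LinearMap.ker f)) := by
    obtain ⟨e⟩ := torObj_dimension_shift M hS i
    exact G0.clsOf_congr e
  rw [torEuler, torEuler, Finset.sum_range_succ', Finset.sum_range_succ',
    Finset.sum_range_succ' _ n]
  simp only [zero_add, hone, hshift, pow_succ, pow_zero, mul_neg, mul_one, neg_neg, neg_smul,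
    one_smul, Finset.sum_neg_distrib]
  abel

/-- Additivity of the Euler characteristic of `Tor` in the first argument. -/
lemma torEuler_add_left (n : ℕ) {M' M M'' N : Type u} [AddCommGroup M'] [AddCommGroup M]
    [AddCommGroup M''] [AddCommGroup N] [Module R M'] [Module R M] [Module R M''] [Module R N]
    [Module.Finite R M'] [Module.Finite R M] [Module.Finite R M''] [Module.Finite R N]
    (hN : HasProjectiveDimensionLE (ModuleCat.of R N) n)
    {f : M' →ₗ[R] M} {g : M →ₗ[R] M''} (hf : Function.Injective f)
    (hg : Function.Surjective g) (hfg : Function.Exact f g) :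
    torEuler n (ModuleCat.of R M) (ModuleCat.of R N) =
      torEuler n (ModuleCat.of R M') (ModuleCat.of R N) +
        torEuler n (ModuleCat.of R M'') (ModuleCat.of R N) := by
  induction n generalizing N with
  | zero =>
    simp only [HasProjectiveDimensionLE, zero_add, ← projective_iff_hasProjectiveDimensionLT_one,
      ← IsProjective.iff_projective] at hN
    simp only [torEuler_zero]
    exact clsOf_tensor_eq_add_of_projective hf hg hfg
  | succ n ih =>
    obtain ⟨P, _, _, _, _, p, hp⟩ := Module.exists_finite_presentation R N
    have hproj : Projective (p.shortComplexKer).X₂ := inferInstance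
    rw [torEuler_succ n (ModuleCat.of R M) p hp, torEuler_succ n (ModuleCat.of R M') p hp,
      torEuler_succ n (ModuleCat.of R M'') p hp,
      ih (((LinearMap.shortExact_shortComplexKer hp).hasProjectiveDimensionLT_X₃_iff n hproj).1 hN),
      clsOf_tensor_eq_add_of_projective (N := P) hf hg hfg]
    abel

/-- Additivity of the Euler characteristic of `Tor` in the second argument. -/
lemma torEuler_add_right (n : ℕ) {M N' N N'' : Type u} [AddCommGroup N']
    [AddCommGroup N] [AddCommGroup N''] [AddCommGroup M] [Module R N'] [Module R N]
    [Module R N''] [Module R M] [Module.Finite R N'] [Module.Finite R N] [Module.Finite R N'']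
    [Module.Finite R M] (hN : HasProjectiveDimensionLE (ModuleCat.of R N'') n)
    {f : N' →ₗ[R] N} {g : N →ₗ[R] N''}
    (hf : Function.Injective f) (hg : Function.Surjective g) (hfg : Function.Exact f g) :
    torEuler n (ModuleCat.of R M) (ModuleCat.of R N) =
      torEuler n (ModuleCat.of R M) (ModuleCat.of R N') +
        torEuler n (ModuleCat.of R M) (ModuleCat.of R N'') := by
  induction n generalizing N' N N'' with
  | zero =>
    simp only [HasProjectiveDimensionLE, zero_add, ← projective_iff_hasProjectiveDimensionLT_one,
      ← IsProjective.iff_projective] at hN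
    simp only [torEuler_zero]
    exact clsOf_tensor_eq_add_of_projective_right hf hg hfg
  | succ n ih =>
    obtain ⟨P', _, _, _, _, p', hp'⟩ := Module.exists_finite_presentation R N'
    obtain ⟨P'', _, _, _, _, p'', hp''⟩ := Module.exists_finite_presentation R N''
    obtain ⟨l, hl⟩ := Module.projective_lifting_property g p'' hg
    have hl' (y : P'') : g (l y) = p'' y := LinearMap.congr_fun hl y
    have hgf (y : N') : g (f y) = 0 := hfg.apply_apply_eq_zero y
    let p : P' × P'' →ₗ[R] N := (f ∘ₗ p').coprod l
    have hp : Function.Surjective p := by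
      intro y
      obtain ⟨b, hb⟩ := hp'' (g y)
      obtain ⟨a, ha⟩ := (hfg (y - l b)).1 (by rw [map_sub, hl', hb, sub_self])
      obtain ⟨c, rfl⟩ := hp' a
      exact ⟨(c, b), by simp [p, ha]⟩
    have hproj : Projective (p''.shortComplexKer).X₂ := inferInstance
    let i : LinearMap.ker p' →ₗ[R] LinearMap.ker p :=
      (LinearMap.inl R P' P'').restrict fun x hx => by
        have : p' x = 0 := hx
        simp [p, this]
    let q : LinearMap.ker p →ₗ[R] LinearMap.ker p'' :=
      (LinearMap.snd R P' P'').restrict fun x hx => by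
        have h : f (p' x.1) + l x.2 = 0 := hx
        have := congrArg g h
        rw [map_add, hgf, hl', zero_add, map_zero] at this
        exact this
    have hi : Function.Injective i := fun x y h =>
      Subtype.ext (congrArg (fun z => z.1.1) h)
    have hq : Function.Surjective q := by
      rintro ⟨b, hb⟩
      obtain ⟨a, ha⟩ := (hfg (l b)).1 (by rw [hl']; exact hb)
      obtain ⟨c, rfl⟩ := hp' a
      exact ⟨⟨(-c, b), by simp [p, ha]⟩, rfl⟩
    have hiq : Function.Exact i q := by
      rintro ⟨⟨a, b⟩, hab⟩
      refine ⟨fun h => ?_, ?_⟩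
      · obtain rfl : b = 0 := congrArg Subtype.val h
        have ha : p' a = 0 := hf (by simpa [p] using hab)
        exact ⟨⟨a, ha⟩, rfl⟩
      · rintro ⟨c, hc⟩
        exact Subtype.ext (congrArg (fun z => z.1.2) hc).symm
    rw [torEuler_succ n (ModuleCat.of R M) p hp, torEuler_succ n (ModuleCat.of R M) p' hp',
      torEuler_succ n (ModuleCat.of R M) p'' hp'',
      ih (((LinearMap.shortExact_shortComplexKer hp'').hasProjectiveDimensionLT_X₃_iff n hproj).1
        hN) hi hq hiq,
      clsOf_tensor_eq_add_of_projective_right (M := M)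
        (LinearMap.inl_injective (R := R) (M := P') (M₂ := P'')) LinearMap.snd_surjective .inl_snd]
    abel

end Additivity

section Pairing

/-- The Euler characteristic of `Tor(M, N)` when finitely generated modules have finite projective
dimension. -/
noncomputable def torEulerOfFinite (hpd : ∀ N : FGMod R, ∃ n, HasProjectiveDimensionLE N.1 n)
    (M N : FGMod R) : G0 R :=
  torEuler (hpd N).choose M.1 N.1

variable (hpd : ∀ N : FGMod R, ∃ n, HasProjectiveDimensionLE N.1 n)

lemma torEulerOfFinite_eq {M N : FGMod R} {n : ℕ}
    (h : ∀ i, n < i → IsZero (torObj i M.1 N.1)) :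
    torEulerOfFinite hpd M N = torEuler n M.1 N.1 :=
  (torEuler_eq_of_isZero (fun _ hi => isZero_torObj_of_hasProjectiveDimensionLE _ M.1 N.1
    (hpd N).choose_spec hi) (le_max_left _ n)).symm.trans
    (torEuler_eq_of_isZero h (le_max_right _ n))

variable [IsNoetherianRing R]

lemma torEulerOfFinite_add_left {M' M M'' : FGMod R} {f : M'.1 →ₗ[R] M.1} {g : M.1 →ₗ[R] M''.1}
    (hf : Function.Injective f) (hg : Function.Surjective g)
    (hfg : LinearMap.range f = LinearMap.ker g) (N : FGMod R) :
    torEulerOfFinite hpd M N = torEulerOfFinite hpd M' N + torEulerOfFinite hpd M'' N := by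
  have := M'.2
  have := M.2
  have := M''.2
  have := N.2
  exact torEuler_add_left _ (hpd N).choose_spec hf hg (LinearMap.exact_iff.2 hfg.symm)

lemma torEulerOfFinite_add_right (M : FGMod R) {N' N N'' : FGMod R} {f : N'.1 →ₗ[R] N.1}
    {g : N.1 →ₗ[R] N''.1} (hf : Function.Injective f) (hg : Function.Surjective g)
    (hfg : LinearMap.range f = LinearMap.ker g) :
    torEulerOfFinite hpd M N = torEulerOfFinite hpd M N' + torEulerOfFinite hpd M N'' := by
  have := N'.2
  have := N.2
  have := N''.2
  have := M.2
  let n := max (hpd N').choose (max (hpd N).choose (hpd N'').choose)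
  have key (L : FGMod R) (hL : (hpd L).choose ≤ n) :
      torEulerOfFinite hpd M L = torEuler n M.1 L.1 :=
    torEulerOfFinite_eq hpd fun i hi => isZero_torObj_of_hasProjectiveDimensionLE _ M.1 L.1
      (hpd L).choose_spec (hL.trans_lt hi)
  have hN'' : HasProjectiveDimensionLE N''.1 n :=
    have : HasProjectiveDimensionLT N''.1 ((hpd N'').choose + 1) := (hpd N'').choose_spec
    hasProjectiveDimensionLT_of_ge _ ((hpd N'').choose + 1) (n + 1) (by omega)
  rw [key N' (by omega), key N (by omega), key N'' (by omega)]
  exact torEuler_add_right n hN'' hf hg (LinearMap.exact_iff.2 hfg.symm)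

/-- The pairing on `G₀(R)` given by the Euler characteristic of `Tor`. -/
noncomputable def torPairing : G0 R →+ G0 R →+ G0 R :=
  G0.lift (fun M => G0.lift (torEulerOfFinite hpd M)
      fun _ _ _ _ _ hf hg hfg => torEulerOfFinite_add_right hpd M hf hg hfg)
    fun M' M M'' f g hf hg hfg => by
      refine G0.hom_ext fun N => ?_
      simpa using torEulerOfFinite_add_left hpd hf hg hfg N

lemma torPairing_mk (M N : FGMod R) :
    torPairing hpd (G0.mk M) (G0.mk N) = torEulerOfFinite hpd M N := by
  rw [torPairing, G0.lift_mk, G0.lift_mk]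

end Pairing

end EulerCharacteristic

/-- Let `R` be a commutative regular noetherian ring.  Then for
every short exact sequence `0 → M' → M → M'' → 0` of finitely generated
`R`-modules and every finitely generated `R`-module `N`, the Euler
characteristic of Tor is additive:
`Σᵢ (-1)^i [Tor_i(M,N)] = Σᵢ (-1)^i [Tor_i(M',N)] + Σᵢ (-1)^i [Tor_i(M'',N)]`
in `G₀(R)` (the sums being finite: they are computed past any degree `n` beyond
which the Tor's vanish), and consequently `([M],[N]) ↦ Σᵢ (-1)^i [Tor_i(M,N)]`
induces a well-defined `ℤ`-bilinear pairing `G₀(R) × G₀(R) → G₀(R)`. -/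
theorem tor_euler_char_additive_and_pairing (R : Type u) [CommRing R]
    [IsNoetherianRing R]
    (hreg : ∀ (𝔭 : Ideal R) (_ : 𝔭.IsPrime), IsRegularLocal (Localization.AtPrime 𝔭)) :
    (∀ (M' M M'' N : FGMod R) (f : M'.1 →ₗ[R] M.1) (g : M.1 →ₗ[R] M''.1),
      Function.Injective f → Function.Surjective g →
      LinearMap.range f = LinearMap.ker g →
      ∀ n : ℕ,
        (∀ i : ℕ, n < i →
          CategoryTheory.Limits.IsZero (torObj i M'.1 N.1) ∧
          CategoryTheory.Limits.IsZero (torObj i M.1 N.1) ∧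
          CategoryTheory.Limits.IsZero (torObj i M''.1 N.1)) →
        ∑ i ∈ Finset.range (n + 1), ((-1 : ℤ) ^ i) • torCls i M.1 N.1 =
          ∑ i ∈ Finset.range (n + 1), ((-1 : ℤ) ^ i) • torCls i M'.1 N.1 +
            ∑ i ∈ Finset.range (n + 1), ((-1 : ℤ) ^ i) • torCls i M''.1 N.1) ∧
    ∃ β : G0 R →+ G0 R →+ G0 R, ∀ (M N : FGMod R) (n : ℕ),
      (∀ i : ℕ, n < i → CategoryTheory.Limits.IsZero (torObj i M.1 N.1)) →
      β (G0.mk M) (G0.mk N) =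
        ∑ i ∈ Finset.range (n + 1), ((-1 : ℤ) ^ i) • torCls i M.1 N.1 := by
  have hpd : ∀ N : FGMod R, ∃ n, CategoryTheory.HasProjectiveDimensionLE N.1 n := fun N => by
    have := N.2
    refine exists_hasProjectiveDimensionLE_of_isRegularLocalRing (fun p hp => ?_) N.1
    exact (IsRegularLocalRing.iff_finrank_cotangentSpace _).2 (hreg p hp).2.symm
  refine ⟨fun M' M M'' N f g hf hg hfg n hn => ?_, torPairing hpd, fun M N n hn => ?_⟩
  · have h := torEulerOfFinite_add_left hpd hf hg hfg N
    rwa [torEulerOfFinite_eq hpd fun i hi => (hn i hi).1,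
      torEulerOfFinite_eq hpd fun i hi => (hn i hi).2.1,
      torEulerOfFinite_eq hpd fun i hi => (hn i hi).2.2] at h
  · exact (torPairing_mk hpd M N).trans (torEulerOfFinite_eq hpd hn)
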